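/- Let g = diag(−1,1,1,1) be the Minkowski metric on Fin 4 → ℝ and let W have Weyl symmetries with respect to g, with Bel-Robinson tensor T. Then for any four causal future-directed vectors u₁, u₂, u₃, u₄ : Fin 4 → ℝ (i.e. ⟨uᵢ,uᵢ⟩ ≤ 0 and uᵢ⁰ > 0 for i = 1,…,4), the superenergy density is non-negative: Σ_{a,b,c,d} T_{abcd} u₁^a u₂^b u₃^c u₄^d ≥ 0. -/

import Mathlib

open Finset

/-- The Minkowski metric `diag(−1,1,1,1)` on `Fin 4 → ℝ` (which is its own inverse). -/
noncomputable def mink : Fin 4 → Fin 4 → ℝ :=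
  fun a b => if a = b then (if a = 0 then -1 else 1) else 0

/-- The Bel-Robinson tensor of `W` with respect to the Minkowski metric:
`T_{ablm} = W_{ajmk} W_b{}^{j}{}_l{}^{k} + W_{ajlk} W_b{}^{j}{}_m{}^{k}
  − (1/8) g_{ab} g_{lm} W_{dfgh} W^{dfgh}`. -/
noncomputable def belRobinsonMink
    (W : Fin 4 → Fin 4 → Fin 4 → Fin 4 → ℝ) (a b l m : Fin 4) : ℝ :=
  (∑ j, ∑ k, W a j m k * (∑ p, ∑ q, mink j p * mink k q * W b p l q))
    + (∑ j, ∑ k, W a j l k * (∑ p, ∑ q, mink j p * mink k q * W b p m q))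
    - (1 / 8) * mink a b * mink l m *
      (∑ d, ∑ f, ∑ e, ∑ h,
        W d f e h *
          (∑ p, ∑ q, ∑ r, ∑ s, mink d p * mink f q * mink e r * mink h s * W p q r s))

/-- The diagonal entries of the Minkowski metric. -/
noncomputable def minkSign (a : Fin 4) : ℝ := if a = 0 then -1 else 1

lemma mink_eq_ite (a b : Fin 4) : mink a b = if a = b then minkSign a else 0 := rfl

/-- The full square `W_{abcd} W^{abcd}`. -/
noncomputable def weylSq (W : Fin 4 → Fin 4 → Fin 4 → Fin 4 → ℝ) : ℝ :=
  ∑ a, ∑ b, ∑ c, ∑ d, minkSign a * minkSign b * minkSign c * minkSign d * W a b c d ^ 2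

lemma belRobinsonMink_eq (W : Fin 4 → Fin 4 → Fin 4 → Fin 4 → ℝ) (a b l m : Fin 4) :
    belRobinsonMink W a b l m =
      (∑ j, ∑ k, minkSign j * minkSign k * (W a j m k * W b j l k + W a j l k * W b j m k))
        - (1 / 8) * mink a b * mink l m * weylSq W := by
  have raise₂ : ∀ (V : Fin 4 → Fin 4 → ℝ) (j k : Fin 4),
      ∑ p, ∑ q, mink j p * mink k q * V p q = minkSign j * minkSign k * V j k := by
    intro V j k
    simp [mink_eq_ite]
  have raise₄ : ∀ d f e h : Fin 4,
      ∑ p, ∑ q, ∑ r, ∑ s, mink d p * mink f q * mink e r * mink h s * W p q r s =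
        minkSign d * minkSign f * minkSign e * minkSign h * W d f e h := by
    intro d f e h
    simp [mink_eq_ite]
  unfold belRobinsonMink weylSq
  simp only [raise₄]
  rw [← Finset.sum_add_distrib]
  congr 1
  · refine Finset.sum_congr rfl fun j _ => ?_
    rw [← Finset.sum_add_distrib]
    refine Finset.sum_congr rfl fun k _ => ?_
    rw [raise₂ (fun p q => W b p l q), raise₂ (fun p q => W b p m q)]
    ring
  · congr 1
    refine Finset.sum_congr rfl fun d _ => Finset.sum_congr rfl fun f _ =>
      Finset.sum_congr rfl fun e _ => Finset.sum_congr rfl fun h _ => ?_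
    ring

/-- The component of a kernel on spinor indices along a Pauli matrix. -/
noncomputable def pauliComponent : Fin 4 → (Fin 2 → Fin 2 → ℂ) → ℂ
  | 0, f => f 0 0 + f 1 1
  | 1, f => f 0 1 + f 1 0
  | 2, f => Complex.I * (f 1 0 - f 0 1)
  | 3, f => f 0 0 - f 1 1

/-- Contraction of a kernel on spinor indices with a real vector, through the Pauli matrices. -/
noncomputable def pauliContract (u : Fin 4 → ℝ) (f : Fin 2 → Fin 2 → ℂ) : ℂ :=
  ∑ a, (u a : ℂ) * pauliComponent a f

lemma pauliComponent_sum_mul (a : Fin 4) (c : Fin 4 → ℂ) (f : Fin 4 → Fin 2 → Fin 2 → ℂ) :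
    pauliComponent a (fun A A' => ∑ b, c b * f b A A') = ∑ b, c b * pauliComponent a (f b) := by
  fin_cases a <;> simp only [Fin.sum_univ_four] <;> simp [pauliComponent] <;> ring

lemma sq_spatial_le_of_causal {u : Fin 4 → ℝ} (hc : ∑ a, ∑ b, mink a b * u a * u b ≤ 0) :
    u 1 ^ 2 + u 2 ^ 2 + u 3 ^ 2 ≤ u 0 ^ 2 := by
  simp [Fin.sum_univ_four, mink] at hc
  linarith

/-- Cholesky factorisation of the Hermitian matrix of a causal future-directed vector. -/
lemma exists_cholesky {u : Fin 4 → ℝ} (hc : ∑ a, ∑ b, mink a b * u a * u b ≤ 0)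
    (hf : 0 < u 0) :
    ∃ a b c d : ℝ, u 0 + u 3 = a ^ 2 ∧ u 0 - u 3 = b ^ 2 + c ^ 2 + d ^ 2 ∧
      u 1 = a * b ∧ u 2 = a * c := by
  have h := sq_spatial_le_of_causal hc
  have hp : 0 ≤ u 0 + u 3 := by nlinarith [sq_nonneg (u 1), sq_nonneg (u 2)]
  have hq : 0 ≤ u 0 - u 3 := by nlinarith [sq_nonneg (u 1), sq_nonneg (u 2)]
  rcases hp.eq_or_lt with h0 | hpos
  · have hu : u 3 = -u 0 := by linarith
    rw [hu] at h
    have h1 : u 1 = 0 := by nlinarith [sq_nonneg (u 1), sq_nonneg (u 2)]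
    have h2 : u 2 = 0 := by nlinarith [sq_nonneg (u 1), sq_nonneg (u 2)]
    refine ⟨0, 0, 0, √(u 0 - u 3), by linarith, ?_, by linarith, by linarith⟩
    rw [Real.sq_sqrt hq]; ring
  · have ha : 0 < √(u 0 + u 3) := Real.sqrt_pos.2 hpos
    have hsq : √(u 0 + u 3) ^ 2 = u 0 + u 3 := Real.sq_sqrt hp
    have hd : 0 ≤ u 0 - u 3 - (u 1 ^ 2 + u 2 ^ 2) / (u 0 + u 3) := by
      rw [sub_nonneg, div_le_iff₀ hpos]
      nlinarith
    refine ⟨√(u 0 + u 3), u 1 / √(u 0 + u 3), u 2 / √(u 0 + u 3),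
      √(u 0 - u 3 - (u 1 ^ 2 + u 2 ^ 2) / (u 0 + u 3)), hsq.symm, ?_,
      by field_simp, by field_simp⟩
    rw [Real.sq_sqrt hd, div_pow, div_pow, hsq]
    ring

/-- A kernel of the form `∑ i, p i x * conj (p i y)`. -/
def IsGram {X : Type} (K : X → X → ℂ) : Prop :=
  ∃ (n : ℕ) (p : Fin n → X → ℂ), ∀ x y, K x y = ∑ i, p i x * starRingEnd ℂ (p i y)

lemma IsGram.pauliContract {X : Type} {K : Fin 2 × X → Fin 2 × X → ℂ} (hK : IsGram K)
    {u : Fin 4 → ℝ} (hc : ∑ a, ∑ b, mink a b * u a * u b ≤ 0) (hf : 0 < u 0) :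
    IsGram fun x y => pauliContract u fun A A' => K (A, x) (A', y) := by
  obtain ⟨n, p, hp⟩ := hK
  obtain ⟨a, b, c, d, h1, h2, h3, h4⟩ := exists_cholesky hc hf
  refine ⟨n + n, Fin.append
    (fun i x => a * p i (0, x) + (b + c * Complex.I) * p i (1, x))
    (fun i x => d * p i (1, x)), fun x y => ?_⟩
  have e0 : u 0 = (a ^ 2 + (b ^ 2 + c ^ 2 + d ^ 2)) / 2 := by linarith
  have e3 : u 3 = (a ^ 2 - (b ^ 2 + c ^ 2 + d ^ 2)) / 2 := by linarith
  simp only [_root_.pauliContract, Fin.sum_univ_four, pauliComponent, hp,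
    Fin.sum_univ_add, Fin.append_left, Fin.append_right,
    ← Finset.sum_add_distrib, ← Finset.sum_sub_distrib, Finset.mul_sum]
  refine Finset.sum_congr rfl fun i _ => ?_
  rw [e0, e3, h3, h4]
  simp only [map_add, map_mul, Complex.conj_ofReal, Complex.conj_I]
  push_cast
  linear_combination ((c:ℂ)^2 * p i (1, x) * starRingEnd ℂ (p i (1, y))) * Complex.I_sq

lemma IsGram.re_nonneg {X : Type} {K : X → X → ℂ} (hK : IsGram K) (x : X) :
    0 ≤ (K x x).re := by
  obtain ⟨n, p, hp⟩ := hK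
  rw [hp, Complex.re_sum]
  refine Finset.sum_nonneg fun i _ => ?_
  rw [Complex.mul_conj, Complex.ofReal_re]
  exact Complex.normSq_nonneg _

/-- The independent components of the Weyl spinor of `W`. -/
noncomputable def weylSpinorCoeff (W : Fin 4 → Fin 4 → Fin 4 → Fin 4 → ℝ) : ℕ → ℂ
  | 0 => ⟨W 0 1 0 1 - W 0 2 0 2 - 2 * W 0 1 1 3, 2 * W 0 1 0 2 - W 0 1 2 3 - W 0 2 1 3⟩
  | 1 => ⟨-W 0 1 0 3 - W 0 2 1 2, W 0 1 1 2 - W 0 2 0 3⟩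
  | 2 => ⟨W 0 3 0 3, -W 0 3 1 2⟩
  | 3 => ⟨W 0 1 0 3 - W 0 2 1 2, -W 0 1 1 2 - W 0 2 0 3⟩
  | _ => ⟨W 0 1 0 1 - W 0 2 0 2 + 2 * W 0 1 1 3, -2 * W 0 1 0 2 - W 0 1 2 3 - W 0 2 1 3⟩

/-- The Weyl spinor of `W`, totally symmetric in its four indices. -/
noncomputable def weylSpinor (W : Fin 4 → Fin 4 → Fin 4 → Fin 4 → ℝ)
    (A B C D : Fin 2) : ℂ :=
  weylSpinorCoeff W (A + B + C + D)

lemma weylSpinor_swap_left (W : Fin 4 → Fin 4 → Fin 4 → Fin 4 → ℝ) (A B C D : Fin 2) :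
    weylSpinor W A B C D = weylSpinor W B A C D := by
  simp only [weylSpinor, Nat.add_comm (A : ℕ)]

lemma weylSpinor_swap_right (W : Fin 4 → Fin 4 → Fin 4 → Fin 4 → ℝ) (A B C D : Fin 2) :
    weylSpinor W A B C D = weylSpinor W A B D C := by
  simp only [weylSpinor, Nat.add_right_comm _ (C : ℕ)]

lemma pauliComponent_comm (a b : Fin 4) (K : Fin 2 → Fin 2 → Fin 2 → Fin 2 → ℂ) :
    (pauliComponent a fun A A' => pauliComponent b fun B B' => K A A' B B') =
      pauliComponent b fun B B' => pauliComponent a fun A A' => K A A' B B' := by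
  fin_cases a <;> fin_cases b <;> simp only [pauliComponent] <;> ring

/-- The components of the real tensor with spinor form `Ψ_{ABCD} conj Ψ_{A'B'C'D'}`. -/
noncomputable def spinorSq (W : Fin 4 → Fin 4 → Fin 4 → Fin 4 → ℝ) (a b c d : Fin 4) : ℝ :=
  (pauliComponent a fun A A' => pauliComponent b fun B B' =>
    pauliComponent c fun C C' => pauliComponent d fun D D' =>
      weylSpinor W A B C D * starRingEnd ℂ (weylSpinor W A' B' C' D')).re

lemma spinorSq_swap_left (W : Fin 4 → Fin 4 → Fin 4 → Fin 4 → ℝ) (a b c d : Fin 4) :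
    spinorSq W a b c d = spinorSq W b a c d := by
  unfold spinorSq
  rw [pauliComponent_comm]
  congr 2
  funext B B'
  congr 1
  funext A A'
  simp only [weylSpinor_swap_left W A B, weylSpinor_swap_left W A' B']

lemma spinorSq_swap_right (W : Fin 4 → Fin 4 → Fin 4 → Fin 4 → ℝ) (a b c d : Fin 4) :
    spinorSq W a b c d = spinorSq W a b d c := by
  unfold spinorSq
  congr 2
  funext A A'
  congr 1
  funext B B'
  rw [pauliComponent_comm]
  simp only [weylSpinor_swap_right W A B, weylSpinor_swap_right W A' B']

lemma belRobinsonMink_swap_left (W : Fin 4 → Fin 4 → Fin 4 → Fin 4 → ℝ) (a b l m : Fin 4) :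
    belRobinsonMink W a b l m = belRobinsonMink W b a l m := by
  have hg : mink a b = mink b a := by
    simp only [mink, eq_comm (a := a)]
    split_ifs <;> simp_all
  rw [belRobinsonMink_eq, belRobinsonMink_eq, hg]
  congr 1
  refine Finset.sum_congr rfl fun j _ => Finset.sum_congr rfl fun k _ => ?_
  ring

lemma belRobinsonMink_swap_right (W : Fin 4 → Fin 4 → Fin 4 → Fin 4 → ℝ) (a b l m : Fin 4) :
    belRobinsonMink W a b l m = belRobinsonMink W a b m l := by
  have hg : mink l m = mink m l := by
    simp only [mink, eq_comm (a := l)]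
    split_ifs <;> simp_all
  rw [belRobinsonMink_eq, belRobinsonMink_eq, hg]
  congr 1
  refine Finset.sum_congr rfl fun j _ => Finset.sum_congr rfl fun k _ => ?_
  ring

lemma forall_fin_four_of_symm {P : Fin 4 → Fin 4 → Prop} (hs : ∀ a b, P a b → P b a)
    (h00 : P 0 0) (h01 : P 0 1) (h02 : P 0 2) (h03 : P 0 3) (h11 : P 1 1) (h12 : P 1 2)
    (h13 : P 1 3) (h22 : P 2 2) (h23 : P 2 3) (h33 : P 3 3) : ∀ a b, P a b := by
  intro a b
  fin_cases a <;> fin_cases b <;> first | assumption | (apply hs; assumption)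

set_option linter.unusedSimpArgs false in
set_option maxHeartbeats 4000000 in
/-- In the Weyl spinor of `W`, the Bel-Robinson tensor is `Ψ_{ABCD} conj Ψ_{A'B'C'D'} / 4`. -/
lemma four_mul_belRobinsonMink (W : Fin 4 → Fin 4 → Fin 4 → Fin 4 → ℝ)
    (hW1 : ∀ a b c d, W a b c d = - W b a c d)
    (hW2 : ∀ a b c d, W a b c d = - W a b d c)
    (hW3 : ∀ a b c d, W a b c d = W c d a b)
    (hW4 : ∀ a b c d, W a b c d + W a c d b + W a d b c = 0)
    (hWtr : ∀ b d, ∑ a, ∑ c, mink a c * W a b c d = 0) :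
    ∀ a b c d, 4 * belRobinsonMink W a b c d = spinorSq W a b c d := by
  have z1 : ∀ a c d, W a a c d = 0 := fun a c d => by linarith [hW1 a a c d]
  have z2 : ∀ a b c, W a b c c = 0 := fun a b c => by linarith [hW2 a b c c]
  have tr : ∀ b d, W 0 b 0 d = W 1 b 1 d + W 2 b 2 d + W 3 b 3 d := by
    intro b d
    have := hWtr b d
    simp [Fin.sum_univ_four, mink] at this
    linarith
  have f10 := hW1 1 0
  have f20 := hW1 2 0
  have f30 := hW1 3 0
  have f21 := hW1 2 1
  have f31 := hW1 3 1
  have f32 := hW1 3 2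
  have g10 := fun a b => hW2 a b 1 0
  have g20 := fun a b => hW2 a b 2 0
  have g30 := fun a b => hW2 a b 3 0
  have g21 := fun a b => hW2 a b 2 1
  have g31 := fun a b => hW2 a b 3 1
  have g32 := fun a b => hW2 a b 3 2
  have t00 := tr 0 0
  have t01 := tr 0 1
  have t02 := tr 0 2
  have t03 := tr 0 3
  have t11 := tr 1 1
  have t12 := tr 1 2
  have t13 := tr 1 3
  have t22 := tr 2 2
  have t23 := tr 2 3
  have t33 := tr 3 3
  have b0 := hW4 0 1 2 3
  simp only [z1, z2, f10, f20, f30, f21, f31, f32, g10, g20, g30, g21, g31, g32]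
    at t00 t01 t02 t03 t11 t12 t13 t22 t23 t33 b0
  have s1 := hW3 0 2 0 1
  have s2 := hW3 0 3 0 1
  have s3 := hW3 0 3 0 2
  have p1 := hW3 1 2 0 1
  have p2 := hW3 1 2 0 2
  have p3 := hW3 1 2 0 3
  have p4 := hW3 1 3 0 1
  have p5 := hW3 1 3 0 2
  have p6 := hW3 1 3 0 3
  have p7 := hW3 2 3 0 1
  have p8 := hW3 2 3 0 2
  have p9 := hW3 2 3 0 3
  have q1 := hW3 1 3 1 2
  have q2 := hW3 2 3 1 2
  have q3 := hW3 2 3 1 3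
  have c33 : W 0 3 0 3 = - W 0 1 0 1 - W 0 2 0 2 := by linarith
  have d1 : W 0 2 2 3 = - W 0 1 1 3 := by linarith
  have d2 : W 0 3 2 3 = W 0 1 1 2 := by linarith
  have d3 : W 0 3 1 3 = - W 0 2 1 2 := by linarith
  have d4 : W 0 3 1 2 = W 0 2 1 3 - W 0 1 2 3 := by linarith
  have m1 : W 2 3 2 3 = - W 0 1 0 1 := by linarith
  have m2 : W 1 3 1 3 = - W 0 2 0 2 := by linarith
  have m3 : W 1 2 1 2 = W 0 1 0 1 + W 0 2 0 2 := by linarith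
  have m4 : W 1 3 2 3 = W 0 1 0 2 := by linarith
  have m5 : W 1 2 2 3 = - W 0 1 0 3 := by linarith
  have m6 : W 1 2 1 3 = W 0 2 0 3 := by linarith
  have n4 : W 2 3 1 3 = W 0 1 0 2 := by linarith
  have n5 : W 2 3 1 2 = - W 0 1 0 3 := by linarith
  have n6 : W 1 3 1 2 = W 0 2 0 3 := by linarith
  rw [d1] at p8
  rw [d2] at p9
  rw [d3] at p6
  rw [d4] at p3
  clear t00 t01 t02 t03 t11 t12 t13 t22 t23 t33 b0 q1 q2 q3 tr
  have sg0 : minkSign 0 = -1 := by simp [minkSign]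
  have sg1 : minkSign 1 = 1 := by simp [minkSign]
  have sg2 : minkSign 2 = 1 := by simp [minkSign]
  have sg3 : minkSign 3 = 1 := by simp [minkSign]
  have sq : weylSq W = 16 * (W 0 1 0 1 ^ 2 + W 0 2 0 2 ^ 2 + W 0 1 0 1 * W 0 2 0 2
      + W 0 1 0 2 ^ 2 + W 0 1 0 3 ^ 2 + W 0 2 0 3 ^ 2
      - W 0 1 2 3 ^ 2 - W 0 2 1 3 ^ 2 + W 0 1 2 3 * W 0 2 1 3
      - W 0 1 1 3 ^ 2 - W 0 1 1 2 ^ 2 - W 0 2 1 2 ^ 2) := by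
    simp only [weylSq, Fin.sum_univ_four, sg0, sg1, sg2, sg3,
      z1, z2, f10, f20, f30, f21, f31, f32, g10, g20, g30, g21, g31, g32,
      s1, s2, s3, p1, p2, p3, p4, p5, p6, p7, p8, p9, c33, d1, d2, d3, d4,
      m1, m2, m3, m4, m5, m6, n4, n5, n6]
    ring
  refine forall_fin_four_of_symm (fun a b h c d => ?_) ?_ ?_ ?_ ?_ ?_ ?_ ?_ ?_ ?_ ?_
  · rw [belRobinsonMink_swap_left, spinorSq_swap_left, h]
  all_goals
    refine forall_fin_four_of_symm (fun c d h => ?_) ?_ ?_ ?_ ?_ ?_ ?_ ?_ ?_ ?_ ?_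
    · rw [belRobinsonMink_swap_right, spinorSq_swap_right, h]
  all_goals
    rw [belRobinsonMink_eq, sq]
    simp only [mink_eq_ite, Fin.sum_univ_four, sg0, sg1, sg2, sg3, Fin.reduceEq, if_true, if_false,
      z1, z2, f10, f20, f30, f21, f31, f32, g10, g20, g30, g21, g31, g32,
      s1, s2, s3, p1, p2, p3, p4, p5, p6, p7, p8, p9, c33, d1, d2, d3, d4,
      m1, m2, m3, m4, m5, m6, n4, n5, n6,
      spinorSq, pauliComponent, weylSpinor, Fin.val_zero, Fin.val_one, Nat.reduceAdd, weylSpinorCoeff,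
      Complex.add_re, Complex.sub_re, Complex.mul_re, Complex.add_im, Complex.sub_im,
      Complex.mul_im, Complex.I_re, Complex.I_im, Complex.conj_re, Complex.conj_im]
    ring

lemma sum_mul_eq_pauliContract (u₁ u₂ u₃ u₄ : Fin 4 → ℝ)
    (K : Fin 2 → Fin 2 → Fin 2 → Fin 2 → Fin 2 → Fin 2 → Fin 2 → Fin 2 → ℂ) :
    (pauliContract u₁ fun A A' => pauliContract u₂ fun B B' => pauliContract u₃ fun C C' =>
      pauliContract u₄ fun D D' => K A A' B B' C C' D D') =
    ∑ a, ∑ b, ∑ c, ∑ d, ((u₁ a * u₂ b * u₃ c * u₄ d : ℝ) : ℂ) *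
      pauliComponent a fun A A' => pauliComponent b fun B B' => pauliComponent c fun C C' =>
        pauliComponent d fun D D' => K A A' B B' C C' D D' := by
  simp only [pauliContract, pauliComponent_sum_mul]
  simp only [Finset.mul_sum]
  refine Finset.sum_congr rfl fun a _ => Finset.sum_congr rfl fun b _ =>
    Finset.sum_congr rfl fun c _ => Finset.sum_congr rfl fun d _ => ?_
  push_cast
  ring

/-- Positivity of the superenergy density: the Bel-Robinson tensor contracted with four
causal future-directed vectors is non-negative. -/
theorem belRobinson_superenergy_nonneg
    (W : Fin 4 → Fin 4 → Fin 4 → Fin 4 → ℝ)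
    (hW1 : ∀ a b c d, W a b c d = - W b a c d)
    (hW2 : ∀ a b c d, W a b c d = - W a b d c)
    (hW3 : ∀ a b c d, W a b c d = W c d a b)
    (hW4 : ∀ a b c d, W a b c d + W a c d b + W a d b c = 0)
    (hWtr : ∀ b d, ∑ a, ∑ c, mink a c * W a b c d = 0)
    (u₁ u₂ u₃ u₄ : Fin 4 → ℝ)
    (hc₁ : ∑ a, ∑ b, mink a b * u₁ a * u₁ b ≤ 0) (hf₁ : 0 < u₁ 0)
    (hc₂ : ∑ a, ∑ b, mink a b * u₂ a * u₂ b ≤ 0) (hf₂ : 0 < u₂ 0)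
    (hc₃ : ∑ a, ∑ b, mink a b * u₃ a * u₃ b ≤ 0) (hf₃ : 0 < u₃ 0)
    (hc₄ : ∑ a, ∑ b, mink a b * u₄ a * u₄ b ≤ 0) (hf₄ : 0 < u₄ 0) :
    0 ≤ ∑ a, ∑ b, ∑ c, ∑ d,
        belRobinsonMink W a b c d * u₁ a * u₂ b * u₃ c * u₄ d := by
  have hgram : IsGram fun x y : Fin 2 × Fin 2 × Fin 2 × Fin 2 × Unit =>
      weylSpinor W x.2.2.2.1 x.2.2.1 x.2.1 x.1 *
        starRingEnd ℂ (weylSpinor W y.2.2.2.1 y.2.2.1 y.2.1 y.1) :=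
    ⟨1, fun _ x => weylSpinor W x.2.2.2.1 x.2.2.1 x.2.1 x.1, fun x y => by simp⟩
  have hpos := ((((hgram.pauliContract hc₄ hf₄).pauliContract hc₃ hf₃).pauliContract
    hc₂ hf₂).pauliContract hc₁ hf₁).re_nonneg ()
  simp only at hpos
  rw [sum_mul_eq_pauliContract u₁ u₂ u₃ u₄ fun A A' B B' C C' D D' =>
    weylSpinor W A B C D * starRingEnd ℂ (weylSpinor W A' B' C' D')] at hpos
  simp only [Complex.re_sum, Complex.re_ofReal_mul] at hpos
  change 0 ≤ ∑ a, ∑ b, ∑ c, ∑ d, u₁ a * u₂ b * u₃ c * u₄ d * spinorSq W a b c d at hpos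
  simp only [← four_mul_belRobinsonMink W hW1 hW2 hW3 hW4 hWtr] at hpos
  refine nonneg_of_mul_nonneg_right (hpos.trans_eq ?_) (by norm_num : (0 : ℝ) < 4)
  simp only [Finset.mul_sum]
  refine Finset.sum_congr rfl fun a _ => Finset.sum_congr rfl fun b _ =>
    Finset.sum_congr rfl fun c _ => Finset.sum_congr rfl fun d _ => ?_
  ring
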